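/- arXiv:1401.3282 — 2 statements merged into one kernel-verified Lean document; each statement's English description precedes it below -/
import Mathlib

section
/- Let G be a group with a gliding system and let 𝒟 ⊆ G satisfy the cube condition. Let A ∈ 𝒟 and let S ⊆ 𝒢 be a pre-cubic set of glides such that sA ∈ 𝒟 for all s ∈ S and stA ∈ 𝒟 for all distinct s, t ∈ S. Then [T]A ∈ 𝒟 for every subset T ⊆ S; in particular [S]A ∈ 𝒟. -/
/-- A gliding system in a group `G`. -/
structure GlidingSystem (G : Type*) [Group G] where
  glides : Set G
  indep : G → G → Prop
  glides_ne_one : ∀ s ∈ glides, s ≠ 1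
  inv_mem : ∀ s ∈ glides, s⁻¹ ∈ glides
  indep_mem_left : ∀ {s t : G}, indep s t → s ∈ glides
  indep_mem_right : ∀ {s t : G}, indep s t → t ∈ glides
  indep_symm : ∀ {s t : G}, indep s t → indep t s
  indep_inv : ∀ {s t : G}, indep s t → indep s⁻¹ t
  indep_mul_comm : ∀ {s t : G}, indep s t → s * t = t * s
  indep_mul_ne_one : ∀ {s t : G}, indep s t → s * t ≠ 1

/-- The product `[S]` of a finite set of pairwise commuting elements of a group
(defined as `1` if the elements do not pairwise commute). -/
noncomputable def finsetProd {G : Type*} [Group G] (S : Finset G) : G :=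
  @dite _ ((S : Set G).Pairwise Commute) (Classical.propDecidable _)
    (fun h => S.noncommProd id h) (fun _ => 1)

/-- A set of glides is pre-cubic if it is finite and its distinct elements are
pairwise independent. -/
def IsPreCubic {G : Type*} [Group G] (GS : GlidingSystem G) (S : Finset G) : Prop :=
  (S : Set G) ⊆ GS.glides ∧ ∀ s ∈ S, ∀ t ∈ S, s ≠ t → GS.indep s t

/-- A set `𝒟 ⊆ G` satisfies the cube condition if whenever seven vertices of a
3-cube belong to `𝒟`, so does the eighth. -/
def CubeCondition {G : Type*} [Group G] (GS : GlidingSystem G) (𝒟 : Set G) : Prop :=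
  ∀ A ∈ 𝒟, ∀ s₁ s₂ s₃ : G, GS.indep s₁ s₂ → GS.indep s₁ s₃ → GS.indep s₂ s₃ →
    s₁ * A ∈ 𝒟 → s₂ * A ∈ 𝒟 → s₃ * A ∈ 𝒟 →
    s₁ * s₂ * A ∈ 𝒟 → s₁ * s₃ * A ∈ 𝒟 → s₂ * s₃ * A ∈ 𝒟 →
    s₁ * s₂ * s₃ * A ∈ 𝒟

theorem IsPreCubic.subset {G : Type*} [Group G] {GS : GlidingSystem G} {S T : Finset G}
    (hS : IsPreCubic GS S) (hTS : T ⊆ S) : IsPreCubic GS T :=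
  ⟨fun _ hs => hS.1 (hTS hs), fun s hs t ht => hS.2 s (hTS hs) t (hTS ht)⟩

theorem IsPreCubic.pairwise_commute {G : Type*} [Group G] {GS : GlidingSystem G} {S : Finset G}
    (hS : IsPreCubic GS S) : (S : Set G).Pairwise Commute :=
  fun s hs t ht hst => GS.indep_mul_comm (hS.2 s hs t ht hst)

theorem finsetProd_empty {G : Type*} [Group G] : finsetProd (∅ : Finset G) = 1 := by
  rw [finsetProd, dif_pos (by simp), Finset.noncommProd_empty]

theorem finsetProd_insert {G : Type*} [Group G] [DecidableEq G] {a : G} {S : Finset G}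
    (ha : a ∉ S) (hS : ((insert a S : Finset G) : Set G).Pairwise Commute) :
    finsetProd (insert a S) = a * finsetProd S := by
  have hS' : (S : Set G).Pairwise Commute :=
    hS.mono (Finset.coe_subset.2 (Finset.subset_insert a S))
  rw [finsetProd, finsetProd, dif_pos hS, dif_pos hS',
    Finset.noncommProd_insert_of_notMem _ _ _ _ ha, id]

/-- The inductive claim in the proof of Theorem 4.4: if `𝒟` satisfies the cube
condition, `A ∈ 𝒟`, and `S` is a pre-cubic set of glides with `sA ∈ 𝒟` for all
`s ∈ S` and `stA ∈ 𝒟` for all distinct `s, t ∈ S`, then `[T]A ∈ 𝒟` for every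
`T ⊆ S`; in particular `[S]A ∈ 𝒟`. -/
theorem cubeCondition_prod_mem {G : Type*} [Group G] (GS : GlidingSystem G)
    (𝒟 : Set G) (hcube : CubeCondition GS 𝒟) (A : G) (hA : A ∈ 𝒟)
    (S : Finset G) (hS : IsPreCubic GS S)
    (h1 : ∀ s ∈ S, s * A ∈ 𝒟)
    (h2 : ∀ s ∈ S, ∀ t ∈ S, s ≠ t → s * t * A ∈ 𝒟) :
    ∀ T ⊆ S, finsetProd T * A ∈ 𝒟 := by
  classical
  intro T
  induction T using Finset.strongInduction with
  | H T ih =>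
    intro hTS
    have hmul : ∀ a U, a ∉ U → insert a U ⊆ T →
        finsetProd (insert a U) = a * finsetProd U := fun a U ha hU =>
      finsetProd_insert ha (hS.subset (hU.trans hTS)).pairwise_commute
    have hmem : ∀ U, U ⊂ T → finsetProd U * A ∈ 𝒟 := fun U hU => ih U hU (hU.subset.trans hTS)
    rcases T.eq_empty_or_nonempty with rfl | ⟨a, ha⟩
    · simpa [finsetProd_empty] using hA
    obtain ⟨U, haU, rfl⟩ : ∃ U, a ∉ U ∧ insert a U = T :=
      ⟨T.erase a, Finset.notMem_erase a T, Finset.insert_erase ha⟩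
    rcases U.eq_empty_or_nonempty with rfl | ⟨b, hb⟩
    · rw [hmul a ∅ haU subset_rfl, finsetProd_empty, mul_one]
      exact h1 a (hTS ha)
    obtain ⟨V, hbV, rfl⟩ : ∃ V, b ∉ V ∧ insert b V = U :=
      ⟨U.erase b, Finset.notMem_erase b U, Finset.insert_erase hb⟩
    have hab : a ≠ b := by grind
    rcases V.eq_empty_or_nonempty with rfl | ⟨c, hc⟩
    · rw [hmul a _ haU subset_rfl, hmul b ∅ hbV (by grind), finsetProd_empty, mul_one]
      exact h2 a (by grind) b (by grind) hab
    obtain ⟨W, hcW, rfl⟩ : ∃ W, c ∉ W ∧ insert c W = V :=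
      ⟨V.erase c, Finset.notMem_erase c V, Finset.insert_erase hc⟩
    have hsub : ∀ x ∈ insert a (insert b (insert c W)), ∀ U ⊆ insert a (insert b (insert c W)),
        x ∉ U → finsetProd U * A ∈ 𝒟 := fun x hx U hU hxU =>
      hmem U (Finset.ssubset_iff_subset_ne.2 ⟨hU, fun h => hxU (h ▸ hx)⟩)
    have h_a := hsub b (by grind) (insert a W) (by grind) (by grind)
    have h_b := hsub a (by grind) (insert b W) (by grind) (by grind)
    have h_c := hsub a (by grind) (insert c W) (by grind) (by grind)
    have h_ab := hsub c (by grind) (insert a (insert b W)) (by grind) (by grind)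
    have h_ac := hsub b (by grind) (insert a (insert c W)) (by grind) (by grind)
    have h_bc := hsub a (by grind) (insert b (insert c W)) (by grind) (by grind)
    rw [hmul a _ (by grind) (by grind)] at h_a h_ab h_ac
    rw [hmul b _ (by grind) (by grind)] at h_b h_ab h_bc
    rw [hmul c _ (by grind) (by grind)] at h_c h_ac h_bc
    rw [hmul a _ (by grind) (by grind), hmul b _ (by grind) (by grind),
      hmul c _ (by grind) (by grind)]
    have key := hcube (finsetProd W * A) (hsub a (by grind) W (by grind) (by grind)) a b c
      (hS.2 a (by grind) b (by grind) hab) (hS.2 a (by grind) c (by grind) (by grind))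
      (hS.2 b (by grind) c (by grind) (by grind))
    simp only [mul_assoc] at key h_a h_b h_c h_ab h_ac h_bc ⊢
    exact key h_a h_b h_c h_ab h_ac h_bc
end

section
/- Two perfect matchings A and B in a graph can be joined by a finite sequence A = A₀, A₁, …, A_n = B of perfect matchings in which each A_{k+1} is obtained from A_k by gliding along an even cycle, if and only if the symmetric difference A Δ B is finite. -/
open scoped symmDiff

variable {V E : Type*}

/-- The set of vertices of a set `s` of edges. -/
def bdry (ends : E → Finset V) (s : Set E) : Set V := ⋃ e ∈ s, (ends e : Set V)

/-- A set `s` of edges is cyclic if it is finite and every vertex of `s` is incident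
to exactly two edges of `s`. -/
def IsCyclicSet (ends : E → Finset V) (s : Set E) : Prop :=
  s.Finite ∧ ∀ v ∈ bdry ends s, {e ∈ s | v ∈ ends e}.ncard = 2

/-- A cycle is a nonempty cyclic set of edges whose only nonempty cyclic subset is
itself. -/
def IsCycle (ends : E → Finset V) (s : Set E) : Prop :=
  IsCyclicSet ends s ∧ s.Nonempty ∧
    ∀ t : Set E, t ⊆ s → IsCyclicSet ends t → t.Nonempty → t = s

/-- An even cycle is a cycle with an even number of edges. -/
def IsEvenCycle (ends : E → Finset V) (s : Set E) : Prop :=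
  IsCycle ends s ∧ Even s.ncard

/-- A matching: distinct edges share no vertices. -/
def IsMatchingSet (ends : E → Finset V) (A : Set E) : Prop :=
  ∀ e ∈ A, ∀ f ∈ A, e ≠ f → Disjoint (ends e : Set V) (ends f : Set V)

/-- A perfect matching: every vertex is incident to exactly one edge of `A`. -/
def IsPerfectMatching (ends : E → Finset V) (A : Set E) : Prop :=
  ∀ v : V, ∃! e : E, e ∈ A ∧ v ∈ ends e

/-- `h` is a half of the even cycle `s` if `h` and `s \ h` are matchings. -/
def IsHalf (ends : E → Finset V) (h s : Set E) : Prop :=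
  h ⊆ s ∧ IsMatchingSet ends h ∧ IsMatchingSet ends (s \ h)

/-- `B` is obtained from `A` by gliding along the even cycle `s`. -/
def IsGliding (ends : E → Finset V) (s A B : Set E) : Prop :=
  IsEvenCycle ends s ∧ IsHalf ends (A ∩ s) s ∧ B = s ∆ A

theorem mem_bdry {ends : E → Finset V} {s : Set E} {v : V} :
    v ∈ bdry ends s ↔ ∃ e ∈ s, v ∈ ends e := by
  simp [bdry]

theorem bdry_mono {ends : E → Finset V} {s t : Set E} (h : s ⊆ t) :
    bdry ends s ⊆ bdry ends t :=
  Set.biUnion_subset_biUnion_left h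

theorem IsMatchingSet.mono {ends : E → Finset V} {A B : Set E} (h : IsMatchingSet ends B)
    (hAB : A ⊆ B) : IsMatchingSet ends A :=
  fun e he f hf => h e (hAB he) f (hAB hf)

theorem IsPerfectMatching.isMatchingSet {ends : E → Finset V} {A : Set E}
    (hA : IsPerfectMatching ends A) : IsMatchingSet ends A := by
  intro e he f hf hne
  rw [Set.disjoint_left]
  exact fun v hve hvf => hne ((hA v).unique ⟨he, hve⟩ ⟨hf, hvf⟩)

/-- A finite matching covers twice as many vertices as it has edges. -/
theorem IsMatchingSet.ncard_bdry {ends : E → Finset V} (hcard : ∀ e, (ends e).card = 2)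
    {M : Set E} (hM : IsMatchingSet ends M) (hfin : M.Finite) :
    (bdry ends M).ncard = 2 * M.ncard := by
  classical
  have hb : bdry ends M = (hfin.toFinset.biUnion ends : Finset V) := by
    ext v
    simp [mem_bdry]
  rw [hb, Set.ncard_coe_finset, Finset.card_biUnion, Finset.sum_congr rfl fun e _ => hcard e,
    Finset.sum_const, Set.ncard_eq_toFinset_card M hfin, smul_eq_mul, mul_comm]
  intro e he f hf hne
  exact Finset.disjoint_coe.mp (hM e (by simpa using he) f (by simpa using hf) hne)

/-- The symmetric difference of two perfect matchings is cyclic as soon as it is finite. -/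
theorem IsPerfectMatching.isCyclicSet_symmDiff {ends : E → Finset V} {A B : Set E}
    (hA : IsPerfectMatching ends A) (hB : IsPerfectMatching ends B) (hfin : (A ∆ B).Finite) :
    IsCyclicSet ends (A ∆ B) := by
  refine ⟨hfin, fun v hv => ?_⟩
  obtain ⟨e, he, hve⟩ := mem_bdry.mp hv
  obtain ⟨a, ⟨ha, hva⟩, hua⟩ := hA v
  obtain ⟨b, ⟨hb, hvb⟩, hub⟩ := hB v
  rw [Set.ncard_eq_two]
  simp only [Set.mem_symmDiff] at he
  refine ⟨a, b, by grind, ?_⟩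
  ext x
  simp only [Set.mem_symmDiff, Set.mem_ofPred_eq, Set.mem_insert_iff, Set.mem_singleton_iff]
  grind

/-- Every nonempty cyclic set contains a cycle. -/
theorem IsCyclicSet.exists_isCycle_subset {ends : E → Finset V} {s : Set E}
    (hs : IsCyclicSet ends s) (hne : s.Nonempty) : ∃ t ⊆ s, IsCycle ends t := by
  have hfin : {t : Set E | t ⊆ s ∧ IsCyclicSet ends t ∧ t.Nonempty}.Finite :=
    hs.1.finite_subsets.subset fun t ht => ht.1
  obtain ⟨t, ⟨hts, htc, htn⟩, hmin⟩ := hfin.exists_minimal ⟨s, subset_rfl, hs, hne⟩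
  exact ⟨t, hts, htc, htn, fun u hut huc hun =>
    hut.antisymm (hmin ⟨hut.trans hts, huc, hun⟩ hut)⟩

/-- A cyclic subset of the symmetric difference of two perfect matchings alternates between
them at each of its vertices. -/
theorem IsCyclicSet.exists_alternating_edges {ends : E → Finset V} {A B s : Set E}
    (hA : IsPerfectMatching ends A) (hB : IsPerfectMatching ends B) (hs : IsCyclicSet ends s)
    (hsub : s ⊆ A ∆ B) {v : V} (hv : v ∈ bdry ends s) :
    (∃ a ∈ s, a ∈ A ∧ v ∈ ends a) ∧ ∃ b ∈ s, b ∈ B \ A ∧ v ∈ ends b := by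
  obtain ⟨x, y, hxy, heq⟩ := Set.ncard_eq_two.mp (hs.2 v hv)
  have hx : x ∈ s ∧ v ∈ ends x := heq.ge (by simp)
  have hy : y ∈ s ∧ v ∈ ends y := heq.ge (by simp)
  have hx' := hsub hx.1
  have hy' := hsub hy.1
  have hAv := (hA v).unique (y₁ := x) (y₂ := y)
  have hBv := (hB v).unique (y₁ := x) (y₂ := y)
  simp only [Set.mem_symmDiff, Set.mem_sdiff] at hx' hy' ⊢
  grind

/-- A cyclic subset of the symmetric difference of two perfect matchings has an even number
of edges. -/
theorem IsCyclicSet.even_ncard {ends : E → Finset V} (hcard : ∀ e, (ends e).card = 2)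
    {A B s : Set E} (hA : IsPerfectMatching ends A) (hB : IsPerfectMatching ends B)
    (hs : IsCyclicSet ends s) (hsub : s ⊆ A ∆ B) : Even s.ncard := by
  have hsB : s \ A ⊆ B := fun e he => by
    have := hsub he.1
    have := he.2
    simp only [Set.mem_symmDiff] at *
    tauto
  have h₁ : bdry ends (s ∩ A) = bdry ends s :=
    (bdry_mono Set.inter_subset_left).antisymm fun v hv => by
      obtain ⟨⟨a, has, haA, hva⟩, -⟩ := hs.exists_alternating_edges hA hB hsub hv
      exact mem_bdry.mpr ⟨a, ⟨has, haA⟩, hva⟩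
  have h₂ : bdry ends (s \ A) = bdry ends s :=
    (bdry_mono Set.sdiff_subset).antisymm fun v hv => by
      obtain ⟨-, b, hbs, hb, hvb⟩ := hs.exists_alternating_edges hA hB hsub hv
      exact mem_bdry.mpr ⟨b, ⟨hbs, hb.2⟩, hvb⟩
  have c₁ := (hA.isMatchingSet.mono Set.inter_subset_right).ncard_bdry hcard
    (hs.1.subset (Set.inter_subset_left (t := A)))
  have c₂ := (hB.isMatchingSet.mono hsB).ncard_bdry hcard (hs.1.subset Set.sdiff_subset)
  have hsum := Set.ncard_inter_add_ncard_sdiff_eq_ncard s A hs.1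
  rw [h₁] at c₁
  rw [h₂] at c₂
  exact ⟨(s ∩ A).ncard, by omega⟩

/-- Switching a perfect matching along a cyclic subset of its symmetric difference with another
perfect matching gives a perfect matching. -/
theorem IsCyclicSet.isPerfectMatching_symmDiff {ends : E → Finset V} {A B s : Set E}
    (hA : IsPerfectMatching ends A) (hB : IsPerfectMatching ends B) (hs : IsCyclicSet ends s)
    (hsub : s ⊆ A ∆ B) : IsPerfectMatching ends (s ∆ A) := by
  intro v
  by_cases hv : v ∈ bdry ends s
  · obtain ⟨⟨a, has, haA, hva⟩, b, hbs, hb, hvb⟩ := hs.exists_alternating_edges hA hB hsub hv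
    refine ⟨b, ⟨Or.inl ⟨hbs, hb.2⟩, hvb⟩, ?_⟩
    rintro x ⟨⟨hxs, hxA⟩ | ⟨hxA, hxs⟩, hvx⟩
    · rcases hsub hxs with hx | hx
      · exact absurd hx.1 hxA
      · exact (hB v).unique ⟨hx.1, hvx⟩ ⟨hb.1, hvb⟩
    · exact absurd ((hA v).unique ⟨hxA, hvx⟩ ⟨haA, hva⟩ ▸ has) hxs
  · have hns : ∀ e, v ∈ ends e → e ∉ s := fun e he hes => hv (mem_bdry.mpr ⟨e, hes, he⟩)
    obtain ⟨a, ⟨ha, hva⟩, hua⟩ := hA v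
    refine ⟨a, ⟨Or.inr ⟨ha, hns a hva⟩, hva⟩, ?_⟩
    rintro x ⟨⟨hxs, -⟩ | ⟨hxA, -⟩, hvx⟩
    · exact absurd hxs (hns x hvx)
    · exact hua x ⟨hxA, hvx⟩

theorem IsCycle.isGliding {ends : E → Finset V} (hcard : ∀ e, (ends e).card = 2)
    {A B s : Set E} (hA : IsPerfectMatching ends A) (hB : IsPerfectMatching ends B)
    (hs : IsCycle ends s) (hsub : s ⊆ A ∆ B) : IsGliding ends s A (s ∆ A) := by
  refine ⟨⟨hs, hs.1.even_ncard hcard hA hB hsub⟩, ⟨Set.inter_subset_right,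
    hA.isMatchingSet.mono Set.inter_subset_left, hB.isMatchingSet.mono ?_⟩, rfl⟩
  rintro e ⟨hes, he⟩
  rcases hsub hes with h | h
  · exact absurd ⟨h.1, hes⟩ he
  · exact h.1

theorem IsGliding.finite_symmDiff {ends : E → Finset V} {s A B : Set E}
    (h : IsGliding ends s A B) : (A ∆ B).Finite := by
  rw [h.2.2, symmDiff_comm s A, symmDiff_symmDiff_cancel_left]
  exact h.1.1.1.1

/-- Lemma 6.4: two perfect matchings `A, B` can be joined by a finite sequence of
glidings along even cycles through perfect matchings if and only if `A Δ B` is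
finite. -/
theorem perfectMatchings_glide_chain_iff (ends : E → Finset V)
    (hcard : ∀ e, (ends e).card = 2) (A B : Set E)
    (hA : IsPerfectMatching ends A) (hB : IsPerfectMatching ends B) :
    (∃ (n : ℕ) (f : ℕ → Set E), f 0 = A ∧ f n = B ∧
        (∀ k ≤ n, IsPerfectMatching ends (f k)) ∧
        ∀ k < n, ∃ s : Set E, IsGliding ends s (f k) (f (k + 1))) ↔
      (A ∆ B).Finite := by
  constructor
  · rintro ⟨n, f, rfl, rfl, -, hglide⟩
    have key : ∀ k ≤ n, (f 0 ∆ f k).Finite := by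
      intro k
      induction k with
      | zero => simp
      | succ k ih =>
        intro hk
        obtain ⟨s, hs⟩ := hglide k hk
        exact ((ih (by omega)).union hs.finite_symmDiff).subset (symmDiff_triangle _ _ _)
    exact key n le_rfl
  · intro hfin
    induction hm : (A ∆ B).ncard using Nat.strong_induction_on generalizing A with
    | _ m ih =>
      rcases (A ∆ B).eq_empty_or_nonempty with hempty | hne
      · exact ⟨0, fun _ => A, rfl, symmDiff_eq_bot.mp hempty, fun _ _ => hA, by simp⟩
      · obtain ⟨s, hsub, hs⟩ := (hA.isCyclicSet_symmDiff hB hfin).exists_isCycle_subset hne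
        have hdiff : (s ∆ A) ∆ B = (A ∆ B) \ s := by
          rw [symmDiff_assoc]
          exact symmDiff_of_le hsub
        have hlt : ((s ∆ A) ∆ B).ncard < m := by
          obtain ⟨e, he⟩ := hs.2.1
          rw [hdiff, ← hm]
          exact Set.ncard_lt_ncard
            (Set.ssubset_iff_of_subset Set.sdiff_subset |>.mpr ⟨e, hsub he, fun h => h.2 he⟩) hfin
        obtain ⟨n, f, hf0, hfn, hfp, hfg⟩ := ih _ hlt (s ∆ A)
          (hs.1.isPerfectMatching_symmDiff hA hB hsub) (hdiff ▸ hfin.subset Set.sdiff_subset) rfl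
        refine ⟨n + 1, fun k => Nat.casesOn k A f, rfl, hfn, ?_, ?_⟩
        · rintro (_ | k) hk
          · exact hA
          · exact hfp k (by omega)
        · rintro (_ | k) hk
          · refine ⟨s, ?_⟩
            change IsGliding ends s A (f 0)
            exact hf0 ▸ hs.isGliding hcard hA hB hsub
          · exact hfg k (by omega)
end
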